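/- With the dG setup below, the range of each of the discrete gradient operators G⁺, G⁻ : V_q → V_q is exactly the subspace V_q^m of mean-zero elements of V_q: (i) for every Φ ∈ V_q one has ∫₀¹ G⁺[Φ] dx = 0 and ∫₀¹ G⁻[Φ] dx = 0; (ii) conversely, for every g ∈ V_q with ∫₀¹ g dx = 0 there exist Φ⁺, Φ⁻ ∈ V_q with G⁺[Φ⁺] = g and G⁻[Φ⁻] = g. -/

import Mathlib

open scoped BigOperators
open MeasureTheory Set

namespace DG

noncomputable def pev (q : ℕ) (c : ℕ → ℕ → ℝ) (n : ℕ) (y : ℝ) : ℝ :=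
  ∑ k ∈ Finset.range (q + 1), c n k * y ^ k

noncomputable def pev' (q : ℕ) (c : ℕ → ℕ → ℝ) (n : ℕ) (y : ℝ) : ℝ :=
  ∑ k ∈ Finset.range (q + 1), (k : ℝ) * c n k * y ^ (k - 1)

noncomputable def inner2 (q N : ℕ) (x : ℕ → ℝ) (c d : ℕ → ℕ → ℝ) : ℝ :=
  ∑ n ∈ Finset.range N, ∫ y in (x n)..(x (n + 1)), pev q c n y * pev q d n y

noncomputable def nsq (q N : ℕ) (x : ℕ → ℝ) (c : ℕ → ℕ → ℝ) : ℝ :=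
  inner2 q N x c c

noncomputable def intg (q N : ℕ) (x : ℕ → ℝ) (c : ℕ → ℕ → ℝ) : ℝ :=
  ∑ n ∈ Finset.range N, ∫ y in (x n)..(x (n + 1)), pev q c n y

noncomputable def valR (q : ℕ) (x : ℕ → ℝ) (c : ℕ → ℕ → ℝ) (n : ℕ) : ℝ :=
  pev q c n (x n)

noncomputable def valL (q N : ℕ) (x : ℕ → ℝ) (c : ℕ → ℕ → ℝ) (n : ℕ) : ℝ :=
  if n = 0 then pev q c (N - 1) (x N) else pev q c (n - 1) (x n)

noncomputable def jmp (q N : ℕ) (x : ℕ → ℝ) (c : ℕ → ℕ → ℝ) (n : ℕ) : ℝ :=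
  valL q N x c n - valR q x c n

noncomputable def Bm (q N : ℕ) (x : ℕ → ℝ) (w Ψ : ℕ → ℕ → ℝ) : ℝ :=
  (∑ n ∈ Finset.range N, ∫ y in (x n)..(x (n + 1)), pev' q w n y * pev q Ψ n y)
    - ∑ n ∈ Finset.range N, jmp q N x w n * valL q N x Ψ n

noncomputable def Bp (q N : ℕ) (x : ℕ → ℝ) (w Ψ : ℕ → ℕ → ℝ) : ℝ :=
  (∑ n ∈ Finset.range N, ∫ y in (x n)..(x (n + 1)), pev' q w n y * pev q Ψ n y)
    - ∑ n ∈ Finset.range N, jmp q N x w n * valR q x Ψ n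

def IsGminus (q N : ℕ) (x : ℕ → ℝ) (w g : ℕ → ℕ → ℝ) : Prop :=
  ∀ Ψ : ℕ → ℕ → ℝ, inner2 q N x g Ψ = Bm q N x w Ψ

def IsGplus (q N : ℕ) (x : ℕ → ℝ) (w g : ℕ → ℕ → ℝ) : Prop :=
  ∀ Ψ : ℕ → ℕ → ℝ, inner2 q N x g Ψ = Bp q N x w Ψ

noncomputable def hseg (x : ℕ → ℝ) (n : ℕ) : ℝ := x (n + 1) - x n

noncomputable def hprev (N : ℕ) (x : ℕ → ℝ) (n : ℕ) : ℝ :=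
  if n = 0 then hseg x (N - 1) else hseg x (n - 1)

noncomputable def dGsq (q N : ℕ) (x : ℕ → ℝ) (w : ℕ → ℕ → ℝ) : ℝ :=
  ∑ n ∈ Finset.range N,
    ((∫ y in (x n)..(x (n + 1)), (pev' q w n y) ^ 2)
      + 2 * (jmp q N x w n) ^ 2 / (hprev N x n + hseg x n))

def Partition (N : ℕ) (x : ℕ → ℝ) : Prop :=
  2 ≤ N ∧ x 0 = 0 ∧ x N = 1 ∧ ∀ n < N, x n < x (n + 1)

def MeshRatio (N : ℕ) (x : ℕ → ℝ) (ρ : ℝ) : Prop :=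
  ∀ n < N, hseg x n ≤ ρ * hseg x ((n + 1) % N) ∧ hseg x ((n + 1) % N) ≤ ρ * hseg x n

end DG

namespace DG
open Polynomial

noncomputable def ilin (a b : ℝ) : ℝ[X] →ₗ[ℝ] ℝ where
  toFun f := ∫ y in a..b, f.eval y
  map_add' f g := by
    simp only [eval_add]
    exact intervalIntegral.integral_add (f.continuous.intervalIntegrable _ _)
      (g.continuous.intervalIntegrable _ _)
  map_smul' c f := by
    simp only [eval_smul, smul_eq_mul, RingHom.id_apply]
    exact intervalIntegral.integral_const_mul _ _

noncomputable def Tfun (q : ℕ) (a b p : ℝ) :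
    (degreeLT ℝ q × ℝ) →ₗ[ℝ] Module.Dual ℝ (degreeLT ℝ (q + 1)) :=
  LinearMap.mk₂ ℝ (fun (r : degreeLT ℝ q × ℝ) (ψ : degreeLT ℝ (q + 1)) =>
      ilin a b ((r.1 : ℝ[X]) * (ψ : ℝ[X])) - r.2 * (ψ : ℝ[X]).eval p)
    (by intro m m' n; simp [add_mul]; ring)
    (by intro c m n; simp [mul_sub, mul_assoc])
    (by intro m n n'; simp [mul_add]; ring)
    (by intro c m n; simp; ring)

theorem Tfun_apply (q : ℕ) (a b p : ℝ) (r : degreeLT ℝ q × ℝ) (ψ : degreeLT ℝ (q + 1)) :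
    Tfun q a b p r ψ = ilin a b ((r.1 : ℝ[X]) * (ψ : ℝ[X])) - r.2 * (ψ : ℝ[X]).eval p := rfl

theorem Tfun_inj (q : ℕ) (a b p s : ℝ) (hab : a < b)
    (h0 : ∀ y ∈ Icc a b, 0 ≤ s * (y - p)) (h1 : ∀ y ∈ Ioo a b, 0 < s * (y - p)) :
    Function.Injective (Tfun q a b p) := by
  rw [injective_iff_map_eq_zero]
  rintro ⟨⟨r, hr⟩, J⟩ h
  have key : ∀ ψ ∈ degreeLT ℝ (q + 1), ilin a b (r * ψ) - J * ψ.eval p = 0 := by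
    intro ψ hψ
    have := congrArg (fun l => l ⟨ψ, hψ⟩) h
    simpa [Tfun_apply] using this
  have hmem : r * (X - C p) ∈ degreeLT ℝ (q + 1) := by
    rw [mem_degreeLT] at hr ⊢
    rw [degree_mul, degree_X_sub_C]
    by_cases h : r = 0
    · subst h
      simp
    · rw [degree_eq_natDegree h] at hr ⊢
      have : r.natDegree < q := by exact_mod_cast hr
      exact_mod_cast Nat.succ_lt_succ this
  have hz := key _ hmem
  have hr0 : r = 0 := by
    apply eq_zero_of_infinite_isRoot
    apply (Ioo_infinite hab).mono
    intro y hy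
    by_contra hne
    have hne' : r.eval y ≠ 0 := hne
    have hpos : 0 < ∫ y in a..b, s * (r.eval y * (r.eval y * (y - p))) := by
      apply intervalIntegral.integral_pos hab
      · exact (continuous_const.mul (r.continuous.mul (r.continuous.mul
          (continuous_id.sub continuous_const)))).continuousOn
      · intro z hz
        have := mul_nonneg (h0 z (Ioc_subset_Icc_self hz)) (sq_nonneg (r.eval z))
        nlinarith
      · refine ⟨y, Ioo_subset_Icc_self hy, ?_⟩
        have := mul_pos (h1 y hy) (sq_pos_of_ne_zero hne')
        nlinarith
    rw [intervalIntegral.integral_const_mul] at hpos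
    have : ilin a b (r * (r * (X - C p))) = ∫ y in a..b, (r.eval y * (r.eval y * (y - p))) := by
      simp [ilin]
    rw [← this] at hpos
    simp at hz
    simp [hz] at hpos
  subst hr0
  have h1m : (1 : ℝ[X]) ∈ degreeLT ℝ (q + 1) := by
    rw [mem_degreeLT, degree_one]
    exact_mod_cast Nat.succ_pos q
  have := key 1 h1m
  simp at this
  simp [this]

theorem Tfun_surj (q : ℕ) (a b p s : ℝ) (hab : a < b)
    (h0 : ∀ y ∈ Icc a b, 0 ≤ s * (y - p)) (h1 : ∀ y ∈ Ioo a b, 0 < s * (y - p)) :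
    Function.Surjective (Tfun q a b p) := by
  have e := fun n => (degreeLTEquiv ℝ n)
  haveI : ∀ n, FiniteDimensional ℝ (degreeLT ℝ n) := fun n =>
    Module.Finite.equiv (degreeLTEquiv ℝ n).symm
  have hd : ∀ n, Module.finrank ℝ (degreeLT ℝ n) = n := fun n => by
    rw [(degreeLTEquiv ℝ n).finrank_eq]; simp
  refine (LinearMap.injective_iff_surjective_of_finrank_eq_finrank ?_).1
    (Tfun_inj q a b p s hab h0 h1)
  rw [Subspace.dual_finrank_eq, Module.finrank_prod, hd, hd]
  simp

noncomputable def toP (m : ℕ) (c : ℕ → ℝ) : ℝ[X] := ∑ k ∈ Finset.range m, C (c k) * X ^ k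

theorem toP_mem (m : ℕ) (c : ℕ → ℝ) : toP m c ∈ degreeLT ℝ m := by
  unfold toP
  refine Submodule.sum_mem _ fun k hk => ?_
  rw [mem_degreeLT]
  refine (degree_C_mul_X_pow_le _ _).trans_lt ?_
  exact_mod_cast Finset.mem_range.1 hk

theorem toP_eval (m : ℕ) (c : ℕ → ℝ) (y : ℝ) :
    (toP m c).eval y = ∑ k ∈ Finset.range m, c k * y ^ k := by
  simp [toP, eval_finset_sum]

theorem cell (q : ℕ) (a b p : ℝ) (hab : a < b) (hp : p = a ∨ p = b) (g : ℕ → ℝ) :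
    ∃ J : ℝ, ∃ w : ℕ → ℝ, ∀ ψ : ℕ → ℝ,
      ∫ y in a..b, (∑ k ∈ Finset.range (q + 1), g k * y ^ k) *
          (∑ k ∈ Finset.range (q + 1), ψ k * y ^ k) =
        (∫ y in a..b, (∑ k ∈ Finset.range (q + 1), (k : ℝ) * w k * y ^ (k - 1)) *
          (∑ k ∈ Finset.range (q + 1), ψ k * y ^ k))
        - J * ∑ k ∈ Finset.range (q + 1), ψ k * p ^ k := by
  have hs : ∃ s : ℝ, (∀ y ∈ Icc a b, 0 ≤ s * (y - p)) ∧ (∀ y ∈ Ioo a b, 0 < s * (y - p)) := by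
    rcases hp with rfl | rfl
    · exact ⟨1, fun y hy => by linarith [hy.1], fun y hy => by linarith [hy.1]⟩
    · exact ⟨-1, fun y hy => by linarith [hy.2], fun y hy => by linarith [hy.2]⟩
  obtain ⟨s, h0, h1⟩ := hs
  obtain ⟨⟨⟨r, hr⟩, J⟩, hT⟩ := Tfun_surj q a b p s hab h0 h1
    ((ilin a b).comp ((LinearMap.mulLeft ℝ (toP (q + 1) g)).comp
      (degreeLT ℝ (q + 1)).subtype))
  refine ⟨J, fun k => r.coeff (k - 1) / k, fun ψ => ?_⟩
  have h := congrArg (fun l => l ⟨toP (q + 1) ψ, toP_mem _ _⟩) hT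
  simp only [Tfun_apply, LinearMap.comp_apply, Submodule.subtype_apply,
    LinearMap.mulLeft_apply, ilin, LinearMap.coe_mk, AddHom.coe_mk, eval_mul, toP_eval] at h
  rw [← h]
  congr 2
  ext y
  congr 1
  rw [Finset.sum_range_succ']
  simp only [Nat.add_sub_cancel, CharP.cast_eq_zero, zero_mul, add_zero]
  have hrq : r.degree < q := mem_degreeLT.1 hr
  by_cases hz : r = 0
  · simp [hz]
  rw [degree_eq_natDegree hz] at hrq
  rw [eval_eq_sum_range' (by exact_mod_cast hrq : r.natDegree < q)]
  refine Finset.sum_congr rfl fun k _ => ?_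
  have : ((k + 1 : ℕ) : ℝ) ≠ 0 := by positivity
  rw [mul_div_cancel₀ _ this]

theorem pev_cont (q : ℕ) (c : ℕ → ℕ → ℝ) (n : ℕ) : Continuous (pev q c n) := by
  unfold pev; fun_prop

theorem pev'_cont (q : ℕ) (c : ℕ → ℕ → ℝ) (n : ℕ) : Continuous (pev' q c n) := by
  unfold pev'; fun_prop

theorem ftc (q : ℕ) (c : ℕ → ℕ → ℝ) (n : ℕ) (a b : ℝ) :
    ∫ y in a..b, pev' q c n y = pev q c n b - pev q c n a := by
  apply intervalIntegral.integral_eq_sub_of_hasDerivAt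
  · intro y _
    unfold pev pev'
    apply HasDerivAt.fun_sum
    intro k _
    have := (hasDerivAt_pow k y).const_mul (c n k)
    exact this.congr_deriv (by ring)
  · exact (pev'_cont q c n).intervalIntegrable _ _

theorem sum_valL (q N : ℕ) (hN : 2 ≤ N) (x : ℕ → ℝ) (c : ℕ → ℕ → ℝ) (F : ℕ → ℝ) :
    ∑ n ∈ Finset.range N, (if n = 0 then F (N - 1) else F (n - 1)) = ∑ n ∈ Finset.range N, F n := by
  obtain ⟨M, rfl⟩ : ∃ M, N = M + 1 := ⟨N - 1, by omega⟩
  rw [Finset.sum_range_succ', Finset.sum_range_succ]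
  simp

theorem valL_eq (q N : ℕ) (hN : 2 ≤ N) (x : ℕ → ℝ) (c : ℕ → ℕ → ℝ) (n : ℕ) :
    valL q N x c n = if n = 0 then pev q c (N - 1) (x (N - 1 + 1))
      else pev q c (n - 1) (x (n - 1 + 1)) := by
  unfold valL
  have : N - 1 + 1 = N := by omega
  rw [this]
  split_ifs with h
  · rfl
  · have : n - 1 + 1 = n := by omega
    rw [this]

theorem sum_jmp (q N : ℕ) (hN : 2 ≤ N) (x : ℕ → ℝ) (c : ℕ → ℕ → ℝ) :
    ∑ n ∈ Finset.range N, jmp q N x c n =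
      ∑ n ∈ Finset.range N, ∫ y in (x n)..(x (n + 1)), pev' q c n y := by
  simp only [ftc, jmp, valR, Finset.sum_sub_distrib, valL_eq q N hN]
  rw [sum_valL q N hN x c (fun n => pev q c n (x (n + 1)))]

def one : ℕ → ℕ → ℝ := fun _ k => if k = 0 then 1 else 0

theorem pev_one (q n : ℕ) (y : ℝ) : pev q one n y = 1 := by
  simp [pev, one]

theorem glue (q N : ℕ) (hN : 2 ≤ N) (x : ℕ → ℝ) (w : ℕ → ℕ → ℝ) (D : ℕ → ℝ)
    (hD : ∑ n ∈ Finset.range N, D n =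
      ∑ n ∈ Finset.range N, ∫ y in (x n)..(x (n + 1)), pev' q w n y) :
    ∃ Φ : ℕ → ℕ → ℝ, (∀ n y, pev' q Φ n y = pev' q w n y) ∧
      ∀ n ∈ Finset.range N, jmp q N x Φ n = D n := by
  let K : ℕ → ℝ := fun n => Nat.rec 0 (fun n Kn => pev q w n (x (n + 1)) + Kn
    - pev q w (n + 1) (x (n + 1)) - D (n + 1)) n
  have hK : ∀ n, K (n + 1) = pev q w n (x (n + 1)) + K n
    - pev q w (n + 1) (x (n + 1)) - D (n + 1) := fun n => rfl
  let Φ : ℕ → ℕ → ℝ := fun n k => w n k + if k = 0 then K n else 0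
  have hΦ : ∀ n y, pev q Φ n y = pev q w n y + K n := by
    intro n y
    simp [pev, Φ, add_mul, Finset.sum_add_distrib]
  have hΦ' : ∀ n y, pev' q Φ n y = pev' q w n y := by
    intro n y
    unfold pev'
    refine Finset.sum_congr rfl fun k _ => ?_
    by_cases hk : k = 0
    · simp [hk]
    · simp [Φ, hk]
  have hs : ∀ n, jmp q N x Φ (n + 1) = D (n + 1) := by
    intro n
    simp only [jmp, valL, valR, hΦ, hK]
    simp
    ring
  refine ⟨Φ, hΦ', ?_⟩
  have h0 : jmp q N x Φ 0 = D 0 := by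
    have h := sum_jmp q N hN x Φ
    simp only [hΦ'] at h
    rw [← hD] at h
    obtain ⟨M, rfl⟩ : ∃ M, N = M + 1 := ⟨N - 1, by omega⟩
    rw [Finset.sum_range_succ', Finset.sum_range_succ'] at h
    simp only [hs] at h
    linarith
  intro n _
  cases n with
  | zero => exact h0
  | succ n => exact hs n

end DG

/-- Range of the discrete gradients, Lemma "The kernel of G±":
(i) every value of G⁺ and of G⁻ has vanishing mean; (ii) every mean-zero
g ∈ V_q lies in the range of G⁺ and in the range of G⁻.  Elements of V_q are
represented by their cellwise polynomial coefficients. -/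
theorem stmt_7 (q N : ℕ) (hq : 1 ≤ q) (x : ℕ → ℝ) (hpart : DG.Partition N x) :
    (∀ Φ g : ℕ → ℕ → ℝ, DG.IsGplus q N x Φ g → DG.intg q N x g = 0) ∧
    (∀ Φ g : ℕ → ℕ → ℝ, DG.IsGminus q N x Φ g → DG.intg q N x g = 0) ∧
    (∀ g : ℕ → ℕ → ℝ, DG.intg q N x g = 0 →
      (∃ Φ : ℕ → ℕ → ℝ, DG.IsGplus q N x Φ g) ∧
      (∃ Φ : ℕ → ℕ → ℝ, DG.IsGminus q N x Φ g)) := by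
  obtain ⟨hN, hx0, hxN, hlt⟩ := hpart
  refine ⟨?_, ?_, ?_⟩
  · intro Φ g h
    have h := h DG.one
    simp only [DG.inner2, DG.Bp, DG.valR, DG.pev_one, mul_one, DG.sum_jmp q N hN, sub_self] at h
    exact h
  · intro Φ g h
    have h := h DG.one
    simp only [DG.inner2, DG.Bm, DG.valL, DG.pev_one, mul_one, ite_self,
      DG.sum_jmp q N hN, sub_self] at h
    exact h
  · intro g hg
    have main : ∀ p : ℕ → ℝ, (∀ n, p n = x n ∨ p n = x (n + 1)) →
        ∃ J : ℕ → ℝ, ∃ w : ℕ → ℕ → ℝ, (∀ n < N, ∀ Ψ : ℕ → ℕ → ℝ,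
          ∫ y in (x n)..(x (n + 1)), DG.pev q g n y * DG.pev q Ψ n y =
            (∫ y in (x n)..(x (n + 1)), DG.pev' q w n y * DG.pev q Ψ n y)
              - J n * DG.pev q Ψ n (p n)) ∧
          ∑ n ∈ Finset.range N, J n =
            ∑ n ∈ Finset.range N, ∫ y in (x n)..(x (n + 1)), DG.pev' q w n y := by
      intro p hp
      have hc : ∀ n, ∃ J : ℝ, ∃ w : ℕ → ℝ, n < N → ∀ ψ : ℕ → ℝ,
          ∫ y in (x n)..(x (n + 1)), (∑ k ∈ Finset.range (q + 1), g n k * y ^ k) *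
              (∑ k ∈ Finset.range (q + 1), ψ k * y ^ k) =
            (∫ y in (x n)..(x (n + 1)),
              (∑ k ∈ Finset.range (q + 1), (k : ℝ) * w k * y ^ (k - 1)) *
              (∑ k ∈ Finset.range (q + 1), ψ k * y ^ k))
            - J * ∑ k ∈ Finset.range (q + 1), ψ k * (p n) ^ k := by
        intro n
        by_cases hn : n < N
        · obtain ⟨J, w, h⟩ := DG.cell q (x n) (x (n + 1)) (p n) (hlt n hn) (hp n) (g n)
          exact ⟨J, w, fun _ => h⟩
        · exact ⟨0, 0, fun h => absurd h hn⟩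
      choose J w h using hc
      have h' : ∀ n < N, ∀ Ψ : ℕ → ℕ → ℝ,
          ∫ y in (x n)..(x (n + 1)), DG.pev q g n y * DG.pev q Ψ n y =
            (∫ y in (x n)..(x (n + 1)), DG.pev' q w n y * DG.pev q Ψ n y)
              - J n * DG.pev q Ψ n (p n) := fun n hn Ψ => h n hn (Ψ n)
      refine ⟨J, w, h', ?_⟩
      have e : DG.intg q N x g = ∑ n ∈ Finset.range N,
          ((∫ y in (x n)..(x (n + 1)), DG.pev' q w n y) - J n) := by
        refine Finset.sum_congr rfl fun n hn => ?_
        have := h' n (Finset.mem_range.1 hn) DG.one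
        simpa only [DG.pev_one, mul_one] using this
      rw [hg, Finset.sum_sub_distrib] at e
      linarith
    constructor
    · obtain ⟨J, w, h, hJ⟩ := main x (fun n => Or.inl rfl)
      obtain ⟨Φ, h1, h2⟩ := DG.glue q N hN x w J hJ
      refine ⟨Φ, fun Ψ => ?_⟩
      unfold DG.inner2 DG.Bp
      rw [← Finset.sum_sub_distrib]
      refine Finset.sum_congr rfl fun n hn => ?_
      rw [h n (Finset.mem_range.1 hn), h2 n hn]
      simp only [h1, DG.valR]
    · obtain ⟨J, w, h, hJ⟩ := main (fun n => x (n + 1)) (fun n => Or.inr rfl)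
      obtain ⟨Φ, h1, h2⟩ := DG.glue q N hN x w
        (fun n => if n = 0 then J (N - 1) else J (n - 1))
        (by rw [DG.sum_valL q N hN x w J, hJ])
      refine ⟨Φ, fun Ψ => ?_⟩
      unfold DG.inner2 DG.Bm
      have e : ∑ n ∈ Finset.range N, DG.jmp q N x Φ n * DG.valL q N x Ψ n
          = ∑ n ∈ Finset.range N, J n * DG.pev q Ψ n (x (n + 1)) := by
        rw [← DG.sum_valL q N hN x w (fun n => J n * DG.pev q Ψ n (x (n + 1)))]
        refine Finset.sum_congr rfl fun n hn => ?_
        rw [h2 n hn, DG.valL_eq q N hN]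
        split_ifs <;> rfl
      rw [e, ← Finset.sum_sub_distrib]
      refine Finset.sum_congr rfl fun n hn => ?_
      rw [h n (Finset.mem_range.1 hn)]
      simp only [h1]
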